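/- Let H=(V,E) be a hypergraph such that k ≤ |f| ≤ K for every edge f, and let each vertex independently receive a weight uniform on (0,1) (almost surely all weights are distinct). For p ∈ (0,1), the expected number of triples (f_1, f_2, v) with f_1, f_2 ∈ E, v ∈ f_1 ∩ f_2, v the maximum-weight vertex of f_1, v the minimum-weight vertex of f_2, and w(v) ∈ ((1−p)/2, (1+p)/2), is at most p·(1+p)^{K−k}·q(H)². -/

import Mathlib

open MeasureTheory Finset
open scoped Classical

/-- The uniform probability measure on the interval `(0,1)`. -/
noncomputable def muW : Measure ℝ := volume.restrict (Set.Ioo (0 : ℝ) 1)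

/-- `q(H) = ∑_{f ∈ E} 2^{-|f|+1}`. -/
noncomputable def qH {V : Type} (E : Finset (Finset V)) : ℝ :=
  ∑ f ∈ E, (2 : ℝ) ^ (1 - (f.card : ℤ))

instance : IsProbabilityMeasure muW := ⟨by simp [muW]⟩

lemma muW_Iic_le (x : ℝ) : muW (Set.Iic x) ≤ ENNReal.ofReal x := by
  rw [muW, Measure.restrict_apply measurableSet_Iic]
  calc volume (Set.Iic x ∩ Set.Ioo 0 1) ≤ volume (Set.Ioc 0 x) :=
        measure_mono fun y hy => ⟨hy.2.1, hy.1⟩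
    _ = ENNReal.ofReal x := by simp

lemma muW_Ici_le (x : ℝ) : muW (Set.Ici x) ≤ ENNReal.ofReal (1 - x) := by
  rw [muW, Measure.restrict_apply measurableSet_Ici]
  calc volume (Set.Ici x ∩ Set.Ioo 0 1) ≤ volume (Set.Ico x 1) :=
        measure_mono fun y hy => ⟨hy.1, hy.2.2⟩
    _ = ENNReal.ofReal (1 - x) := by simp

/-- The weightings for which `v` is a conflicting vertex of the pair `(f₁, f₂)`. -/
def conflictSet {V : Type} (f₁ f₂ : Finset V) (v : V) (p : ℝ) : Set (V → ℝ) :=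
  {ω | (∀ u ∈ f₁, ω u ≤ ω v) ∧ (∀ u ∈ f₂, ω v ≤ ω u) ∧ (1 - p) / 2 < ω v ∧ ω v < (1 + p) / 2}

/-- The weights of `u` that are compatible with `v` having weight `x` and being the maximum of
`f₁` and the minimum of `f₂`. -/
def compatibleWeights {V : Type} (f₁ f₂ : Finset V) (x : ℝ) (u : V) : Set ℝ :=
  {y | (u ∈ f₁ → y ≤ x) ∧ (u ∈ f₂ → x ≤ y)}

lemma measurableSet_conflictSet {V : Type} [Fintype V] (f₁ f₂ : Finset V) (v : V) (p : ℝ) :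
    MeasurableSet (conflictSet f₁ f₂ v p) := by
  unfold conflictSet
  measurability

/-- Conditioning on the weight `x` of `v`, the weights of the other vertices are independent. -/
lemma measure_conflictSet_le {V : Type} [Fintype V] [DecidableEq V]
    (f₁ f₂ : Finset V) (v : V) (p : ℝ) :
    (Measure.pi fun _ : V => muW) (conflictSet f₁ f₂ v p) ≤
      ∫⁻ x in Set.Ioo ((1 - p) / 2) ((1 + p) / 2),
        ∏ u ∈ univ.erase v, muW (compatibleWeights f₁ f₂ x u) ∂muW := by
  have hA := measurableSet_conflictSet f₁ f₂ v p
  rw [← lintegral_indicator_one hA,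
    lintegral_eq_lmarginal_univ (μ := fun _ : V => muW) (fun _ => 0),
    ← insert_erase (mem_univ v),
    lmarginal_insert _ (measurable_one.indicator hA) (notMem_erase v univ),
    insert_erase (mem_univ v), ← lintegral_indicator measurableSet_Ioo]
  refine lintegral_mono fun x => ?_
  unfold lmarginal
  by_cases hx : x ∈ Set.Ioo ((1 - p) / 2) ((1 + p) / 2)
  · rw [Set.indicator_of_mem hx, ← prod_coe_sort, ← Measure.pi_pi]
    refine le_trans (lintegral_mono fun z => ?_) (lintegral_indicator_one_le _)
    by_cases hz : Function.updateFinset (Function.update (fun _ => 0) v x) (univ.erase v) z ∈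
        conflictSet f₁ f₂ v p
    · rw [Set.indicator_of_mem hz, Set.indicator_of_mem]
      · rfl
      · rintro ⟨u, hu⟩ -
        have h₁ := hz.1 u
        have h₂ := hz.2.1 u
        have huv := (mem_erase.1 hu).1
        simp only [Function.updateFinset, hu, dite_true, notMem_erase, dite_false,
          Function.update_self] at h₁ h₂
        exact ⟨h₁, h₂⟩
    · rw [Set.indicator_of_notMem hz]
      exact zero_le
  · rw [Set.indicator_of_notMem hx, nonpos_iff_eq_zero]
    refine (lintegral_congr fun z => Set.indicator_of_notMem (fun h => hx ?_) _).trans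
      lintegral_zero
    simpa [Function.updateFinset] using h.2.2

lemma pow_mul_one_sub_pow_le {p x : ℝ} (hp0 : 0 ≤ p) (hp1 : p ≤ 1)
    (hx : x ∈ Set.Ioo ((1 - p) / 2) ((1 + p) / 2)) {a b n : ℕ} (hab : a ≤ b + n)
    (hba : b ≤ a + n) :
    x ^ a * (1 - x) ^ b ≤ (1 + p) ^ n * ((1 / 2) ^ a * (1 / 2) ^ b) := by
  wlog h : a ≤ b generalizing a b x
  · have := this (x := 1 - x) ⟨by linarith [hx.2], by linarith [hx.1]⟩ hba hab (by omega)
    rw [sub_sub_cancel] at this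
    linarith
  obtain ⟨c, rfl⟩ := Nat.exists_eq_add_of_le h
  have hx0 : 0 ≤ x := by linarith [hx.1]
  have hx1 : 0 ≤ 1 - x := by linarith [hx.2]
  calc x ^ a * (1 - x) ^ (a + c) = (x * (1 - x)) ^ a * (1 - x) ^ c := by
        rw [mul_pow, pow_add]; ring
    _ ≤ (1 / 2 * (1 / 2)) ^ a * ((1 + p) * (1 / 2)) ^ c := by
        refine mul_le_mul (pow_le_pow_left₀ (by positivity) ?_ a)
          (pow_le_pow_left₀ hx1 ?_ c) (by positivity) (by positivity)
        · nlinarith [sq_nonneg (2 * x - 1)]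
        · linarith [hx.1]
    _ = (1 + p) ^ c * ((1 / 2) ^ a * (1 / 2) ^ (a + c)) := by
        rw [mul_pow, mul_pow, pow_add]; ring
    _ ≤ (1 + p) ^ n * ((1 / 2) ^ a * (1 / 2) ^ (a + c)) := by
        gcongr
        · linarith
        · omega

lemma measure_conflictSet_eq_zero {V : Type} [Fintype V] [DecidableEq V]
    {f₁ f₂ : Finset V} {u v : V} (huv : u ≠ v) (h₁ : u ∈ f₁) (h₂ : u ∈ f₂) (p : ℝ) :
    (Measure.pi fun _ : V => muW) (conflictSet f₁ f₂ v p) = 0 := by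
  rw [← nonpos_iff_eq_zero]
  refine (measure_conflictSet_le f₁ f₂ v p).trans_eq ?_
  refine (lintegral_congr fun x => ?_).trans lintegral_zero
  refine prod_eq_zero (mem_erase.2 ⟨huv, mem_univ u⟩) ?_
  have : compatibleWeights f₁ f₂ x u = {x} := by
    ext y
    simp [compatibleWeights, h₁, h₂, le_antisymm_iff]
  rw [this, muW]
  exact measure_singleton x

lemma muW_compatibleWeights_le {V : Type} [DecidableEq V] (f₁ f₂ : Finset V) {x : ℝ} {u : V}
    (hu : ¬ (u ∈ f₁ ∧ u ∈ f₂)) :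
    muW (compatibleWeights f₁ f₂ x u) ≤
      (if u ∈ f₁ then ENNReal.ofReal x else 1) *
        (if u ∈ f₂ then ENNReal.ofReal (1 - x) else 1) := by
  by_cases h₁ : u ∈ f₁ <;> by_cases h₂ : u ∈ f₂
  · exact absurd ⟨h₁, h₂⟩ hu
  · simpa [h₁, h₂, compatibleWeights, Set.Iic] using muW_Iic_le x
  · simpa [h₁, h₂, compatibleWeights, Set.Ici] using muW_Ici_le x
  · simpa [h₁, h₂] using prob_le_one

lemma measureReal_conflictSet_le {V : Type} [Fintype V] [DecidableEq V]
    {f₁ f₂ : Finset V} {v : V} (hv : f₁ ∩ f₂ = {v}) {p : ℝ} (hp0 : 0 ≤ p) (hp1 : p ≤ 1)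
    {n : ℕ} (h₁₂ : f₁.card ≤ f₂.card + n) (h₂₁ : f₂.card ≤ f₁.card + n) :
    (Measure.pi fun _ : V => muW).real (conflictSet f₁ f₂ v p) ≤
      p * (1 + p) ^ n * ((2 : ℝ) ^ (1 - (f₁.card : ℤ)) * (2 : ℝ) ^ (1 - (f₂.card : ℤ))) := by
  have hmem : v ∈ f₁ ∩ f₂ := by simp [hv]
  obtain ⟨hv₁, hv₂⟩ := mem_inter.1 hmem
  have hpow : ∀ f : Finset V, v ∈ f → (2 : ℝ) ^ (1 - (f.card : ℤ)) = (1 / 2) ^ (f.erase v).card := by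
    intro f hf
    rw [← card_erase_add_one hf, one_div, inv_pow, ← zpow_natCast, ← zpow_neg]
    congr 1
    push_cast
    ring
  have hprod : ∀ f : Finset V, ∀ c : ENNReal,
      ∏ u ∈ univ.erase v, (if u ∈ f then c else 1) = c ^ (f.erase v).card := by
    intro f c
    rw [prod_ite, prod_const, prod_const_one, mul_one]
    congr 2
    ext u
    simp
  have hcard₁ := card_erase_add_one hv₁
  have hcard₂ := card_erase_add_one hv₂
  rw [hpow f₁ hv₁, hpow f₂ hv₂]
  set C : ℝ := (1 + p) ^ n * ((1 / 2) ^ (f₁.erase v).card * (1 / 2) ^ (f₂.erase v).card) with hC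
  refine ENNReal.toReal_le_of_le_ofReal (by positivity) ?_
  calc (Measure.pi fun _ : V => muW) (conflictSet f₁ f₂ v p)
      ≤ ∫⁻ x in Set.Ioo ((1 - p) / 2) ((1 + p) / 2),
          ∏ u ∈ univ.erase v, muW (compatibleWeights f₁ f₂ x u) ∂muW :=
        measure_conflictSet_le f₁ f₂ v p
    _ ≤ ∫⁻ _ in Set.Ioo ((1 - p) / 2) ((1 + p) / 2), ENNReal.ofReal C ∂muW := by
        refine setLIntegral_mono measurable_const fun x hx => ?_
        refine (prod_le_prod' fun u hu => muW_compatibleWeights_le f₁ f₂ fun h => ?_).trans ?_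
        · have : u ∈ f₁ ∩ f₂ := mem_inter.2 h
          rw [hv, mem_singleton] at this
          exact (mem_erase.1 hu).1 this
        · have hx0 : 0 ≤ x := by linarith [hx.1]
          have hx1 : 0 ≤ 1 - x := by linarith [hx.2]
          rw [prod_mul_distrib, hprod, hprod, ← ENNReal.ofReal_pow hx0, ← ENNReal.ofReal_pow hx1,
            ← ENNReal.ofReal_mul (by positivity)]
          exact ENNReal.ofReal_le_ofReal
            (pow_mul_one_sub_pow_le hp0 hp1 hx (by omega) (by omega))
    _ = ENNReal.ofReal C * muW (Set.Ioo ((1 - p) / 2) ((1 + p) / 2)) := by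
        rw [setLIntegral_const]
    _ ≤ ENNReal.ofReal C * ENNReal.ofReal p := by
        gcongr
        refine (Measure.restrict_apply_le _ _).trans_eq ?_
        rw [Real.volume_Ioo]
        congr 1
        ring
    _ = _ := by
        rw [← ENNReal.ofReal_mul (by positivity), hC]
        congr 1
        ring

lemma sum_measureReal_conflictSet_le {V : Type} [Fintype V] [DecidableEq V]
    (f₁ f₂ : Finset V) {p : ℝ} (hp0 : 0 ≤ p) (hp1 : p ≤ 1)
    {n : ℕ} (h₁₂ : f₁.card ≤ f₂.card + n) (h₂₁ : f₂.card ≤ f₁.card + n) :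
    ∑ v ∈ f₁ ∩ f₂, (Measure.pi fun _ : V => muW).real (conflictSet f₁ f₂ v p) ≤
      p * (1 + p) ^ n * ((2 : ℝ) ^ (1 - (f₁.card : ℤ)) * (2 : ℝ) ^ (1 - (f₂.card : ℤ))) := by
  by_cases h : ∃ v, f₁ ∩ f₂ = {v}
  · obtain ⟨v, hv⟩ := h
    rw [hv, sum_singleton]
    exact measureReal_conflictSet_le hv hp0 hp1 h₁₂ h₂₁
  · rw [sum_eq_zero]
    · positivity
    · intro v hv
      obtain ⟨u, hu, huv⟩ : ∃ u ∈ f₁ ∩ f₂, u ≠ v := by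
        by_contra! hc
        exact h ⟨v, eq_singleton_iff_unique_mem.2 ⟨hv, hc⟩⟩
      rw [mem_inter] at hu
      rw [measureReal_def, measure_conflictSet_eq_zero huv hu.1 hu.2, ENNReal.toReal_zero]

/-- Suppose every edge `f` satisfies `k ≤ |f| ≤ K` and each vertex gets an independent
uniform weight in `(0,1)`.  For `p ∈ (0,1)`, the expected number of triples `(f₁, f₂, v)`
with `v ∈ f₁ ∩ f₂`, `v` the maximum-weight vertex of `f₁`, `v` the minimum-weight vertex of
`f₂`, and `w(v) ∈ ((1−p)/2, (1+p)/2)`, is at most `p·(1+p)^{K−k}·q(H)²`. -/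
theorem expected_conflicting_pairs {V : Type} [Fintype V] [DecidableEq V]
    (E : Finset (Finset V)) (hE : ∀ f ∈ E, 2 ≤ f.card)
    (k K : ℕ) (hkK : k ≤ K) (hbounds : ∀ f ∈ E, k ≤ f.card ∧ f.card ≤ K)
    (p : ℝ) (hp0 : 0 < p) (hp1 : p < 1) :
    ∫ ω : V → ℝ,
        (∑ f₁ ∈ E, ∑ f₂ ∈ E,
          (((f₁ ∩ f₂).filter fun v =>
            (∀ u ∈ f₁, ω u ≤ ω v) ∧ (∀ u ∈ f₂, ω v ≤ ω u) ∧
            (1 - p) / 2 < ω v ∧ ω v < (1 + p) / 2).card : ℝ))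
        ∂(Measure.pi fun _ : V => muW) ≤
      p * (1 + p) ^ (K - k) * qH E ^ 2 := by
  have hcard : ∀ (f₁ f₂ : Finset V) (ω : V → ℝ),
      (((f₁ ∩ f₂).filter fun v => (∀ u ∈ f₁, ω u ≤ ω v) ∧ (∀ u ∈ f₂, ω v ≤ ω u) ∧
        (1 - p) / 2 < ω v ∧ ω v < (1 + p) / 2).card : ℝ) =
      ∑ v ∈ f₁ ∩ f₂, (conflictSet f₁ f₂ v p).indicator 1 ω := by
    intro f₁ f₂ ω
    rw [card_filter]
    push_cast
    refine sum_congr rfl fun v _ => ?_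
    rw [Set.indicator_apply]
    exact if_congr Iff.rfl rfl rfl
  have hint : ∀ (f₁ f₂ : Finset V) (v : V), Integrable
      ((conflictSet f₁ f₂ v p).indicator (1 : (V → ℝ) → ℝ)) (Measure.pi fun _ : V => muW) :=
    fun f₁ f₂ v => (integrable_const (1 : ℝ)).indicator (measurableSet_conflictSet f₁ f₂ v p)
  simp only [hcard]
  rw [integral_finsetSum _ fun f₁ _ => integrable_finsetSum _ fun f₂ _ =>
    integrable_finsetSum _ fun v _ => hint f₁ f₂ v, qH, sq, sum_mul_sum, mul_sum]
  refine sum_le_sum fun f₁ hf₁ => ?_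
  rw [integral_finsetSum _ fun f₂ _ => integrable_finsetSum _ fun v _ => hint f₁ f₂ v, mul_sum]
  refine sum_le_sum fun f₂ hf₂ => ?_
  rw [integral_finsetSum _ fun v _ => hint f₁ f₂ v]
  simp only [integral_indicator_one (measurableSet_conflictSet _ _ _ _)]
  have h₁ := hbounds f₁ hf₁
  have h₂ := hbounds f₂ hf₂
  exact sum_measureReal_conflictSet_le f₁ f₂ hp0.le hp1.le (by omega) (by omega)
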